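/- arXiv:2111.14449 — 3 statements merged into one kernel-verified Lean document; each statement's English description precedes it below -/
import Mathlib

section
/- Let m, n be positive integers, λ a nonzero real number, Q an (n+m)×m real matrix with orthonormal columns (QᵀQ = Iₘ), R an invertible m×m real matrix, and a₁ ∈ ℝⁿ. Put â := [a₁; 0] ∈ ℝ^{n+m} (a₁ followed by m zeros), h := Qᵀâ ∈ ℝᵐ, μ := sqrt(‖(I_{n+m} − QQᵀ)â‖² + λ²) (so μ > 0), and c := (1/μ)(I_{n+m} − QQᵀ)â ∈ ℝ^{n+m}. Then the (n+m+1)×(m+1) block matrix [[QR, â],[0, λ]] factors as [[QR, â],[0, λ]] = Q̂ R̂, where Q̂ := [[Q, c],[0, λ/μ]] is an (n+m+1)×(m+1) matrix and R̂ := [[R, h],[0, μ]] is an invertible (m+1)×(m+1) matrix; moreover Q̂ has orthonormal columns: Q̂ᵀQ̂ = I_{m+1}. -/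
open Matrix

/-- A column matrix (single column indexed by `Unit`) built from a vector. -/
def colM {k : Type*} (v : k → ℝ) : Matrix k Unit ℝ :=
  Matrix.of fun i _ => v i

/-- `â = [a₁; 0] ∈ ℝ^{n+m}`. -/
def ahat {m n : ℕ} (a₁ : Fin n → ℝ) : Fin n ⊕ Fin m → ℝ :=
  Sum.elim a₁ 0

/-- `h = Qᵀ â`. -/
def hvec {m n : ℕ} (Q : Matrix (Fin n ⊕ Fin m) (Fin m) ℝ) (a₁ : Fin n → ℝ) : Fin m → ℝ :=
  Qᵀ *ᵥ ahat a₁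

/-- `μ = sqrt(‖(I − Q Qᵀ) â‖² + λ²)`. -/
noncomputable def mu {m n : ℕ} (Q : Matrix (Fin n ⊕ Fin m) (Fin m) ℝ)
    (a₁ : Fin n → ℝ) (lam : ℝ) : ℝ :=
  Real.sqrt ((∑ i, (((1 - Q * Qᵀ) *ᵥ ahat a₁) i) ^ 2) + lam ^ 2)

/-- `c = (1/μ)(I − Q Qᵀ) â`. -/
noncomputable def cvec {m n : ℕ} (Q : Matrix (Fin n ⊕ Fin m) (Fin m) ℝ)
    (a₁ : Fin n → ℝ) (lam : ℝ) : Fin n ⊕ Fin m → ℝ :=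
  (1 / mu Q a₁ lam) • ((1 - Q * Qᵀ) *ᵥ ahat a₁)

theorem mul_colM {l k : Type*} [Fintype k] (A : Matrix l k ℝ) (v : k → ℝ) :
    A * colM v = colM (A *ᵥ v) := rfl

theorem colM_add {k : Type*} (v w : k → ℝ) : colM v + colM w = colM (v + w) := rfl

theorem colM_mul_smul_one {k : Type*} (v : k → ℝ) (r : ℝ) :
    colM v * (r • (1 : Matrix Unit Unit ℝ)) = colM (r • v) := by
  ext i j
  simp [colM]

theorem transpose_colM_mul_colM {k : Type*} [Fintype k] (v w : k → ℝ) :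
    (colM v)ᵀ * colM w = (v ⬝ᵥ w) • (1 : Matrix Unit Unit ℝ) := by
  ext i j
  simp [colM, Matrix.mul_apply, dotProduct]

theorem mu_pos {m n : ℕ} (Q : Matrix (Fin n ⊕ Fin m) (Fin m) ℝ) (a₁ : Fin n → ℝ)
    {lam : ℝ} (hlam : lam ≠ 0) : 0 < mu Q a₁ lam := by
  unfold mu
  positivity

theorem mu_sq {m n : ℕ} (Q : Matrix (Fin n ⊕ Fin m) (Fin m) ℝ) (a₁ : Fin n → ℝ) (lam : ℝ) :
    mu Q a₁ lam ^ 2 =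
      ((1 - Q * Qᵀ) *ᵥ ahat a₁) ⬝ᵥ ((1 - Q * Qᵀ) *ᵥ ahat a₁) + lam ^ 2 := by
  rw [mu, Real.sq_sqrt (by positivity)]
  simp only [dotProduct, sq]

theorem mulVec_hvec_add_mu_smul_cvec {m n : ℕ} (Q : Matrix (Fin n ⊕ Fin m) (Fin m) ℝ)
    (a₁ : Fin n → ℝ) {lam : ℝ} (hlam : lam ≠ 0) :
    Q *ᵥ hvec Q a₁ + mu Q a₁ lam • cvec Q a₁ lam = ahat a₁ := by
  rw [cvec, smul_smul, mul_one_div_cancel (mu_pos Q a₁ hlam).ne', one_smul, hvec,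
    Matrix.mulVec_mulVec, Matrix.sub_mulVec, Matrix.one_mulVec, add_sub_cancel]

theorem transpose_mulVec_cvec {m n : ℕ} {Q : Matrix (Fin n ⊕ Fin m) (Fin m) ℝ}
    (hQ : Qᵀ * Q = 1) (a₁ : Fin n → ℝ) (lam : ℝ) : Qᵀ *ᵥ cvec Q a₁ lam = 0 := by
  rw [cvec, Matrix.mulVec_smul, Matrix.mulVec_mulVec, Matrix.mul_sub, ← Matrix.mul_assoc, hQ,
    Matrix.mul_one, Matrix.one_mul, sub_self, Matrix.zero_mulVec, smul_zero]

theorem cvec_dotProduct_cvec_add {m n : ℕ} (Q : Matrix (Fin n ⊕ Fin m) (Fin m) ℝ)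
    (a₁ : Fin n → ℝ) {lam : ℝ} (hlam : lam ≠ 0) :
    cvec Q a₁ lam ⬝ᵥ cvec Q a₁ lam + (lam / mu Q a₁ lam) * (lam / mu Q a₁ lam) = 1 := by
  have hmu := (mu_pos Q a₁ hlam).ne'
  have hsq := mu_sq Q a₁ lam
  simp only [cvec, smul_dotProduct, dotProduct_smul, smul_eq_mul]
  field_simp
  exact hsq.symm

theorem stmt7 {m n : ℕ} (hm : 0 < m) (hn : 0 < n) (lam : ℝ) (hlam : lam ≠ 0)
    (Q : Matrix (Fin n ⊕ Fin m) (Fin m) ℝ) (hQ : Qᵀ * Q = 1)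
    (R : Matrix (Fin m) (Fin m) ℝ) (hR : IsUnit R) (a₁ : Fin n → ℝ) :
    0 < mu Q a₁ lam ∧
    Matrix.fromBlocks (Q * R) (colM (ahat (m := m) a₁))
        (0 : Matrix Unit (Fin m) ℝ) (lam • (1 : Matrix Unit Unit ℝ)) =
      Matrix.fromBlocks Q (colM (cvec Q a₁ lam))
          (0 : Matrix Unit (Fin m) ℝ) ((lam / mu Q a₁ lam) • (1 : Matrix Unit Unit ℝ)) *
        Matrix.fromBlocks R (colM (hvec Q a₁))
          (0 : Matrix Unit (Fin m) ℝ) (mu Q a₁ lam • (1 : Matrix Unit Unit ℝ)) ∧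
    IsUnit (Matrix.fromBlocks R (colM (hvec Q a₁))
        (0 : Matrix Unit (Fin m) ℝ) (mu Q a₁ lam • (1 : Matrix Unit Unit ℝ))) ∧
    (Matrix.fromBlocks Q (colM (cvec Q a₁ lam))
        (0 : Matrix Unit (Fin m) ℝ) ((lam / mu Q a₁ lam) • (1 : Matrix Unit Unit ℝ)))ᵀ *
      Matrix.fromBlocks Q (colM (cvec Q a₁ lam))
        (0 : Matrix Unit (Fin m) ℝ) ((lam / mu Q a₁ lam) • (1 : Matrix Unit Unit ℝ)) = 1 := by
  have hmu := mu_pos Q a₁ hlam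
  refine ⟨hmu, ?_, ?_, ?_⟩
  · rw [Matrix.fromBlocks_multiply, mul_colM, colM_mul_smul_one, colM_add,
      mulVec_hvec_add_mu_smul_cvec Q a₁ hlam]
    simp [smul_smul, mul_div_cancel₀, hmu.ne']
  · rw [Matrix.isUnit_fromBlocks_zero₂₁]
    exact ⟨hR, isUnit_one.smul (Units.mk0 _ hmu.ne')⟩
  · have hcQ : (colM (cvec Q a₁ lam))ᵀ * Q = 0 := by
      rw [← Matrix.transpose_transpose Q, ← Matrix.transpose_mul, Matrix.transpose_transpose Q,
        mul_colM, transpose_mulVec_cvec hQ]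
      rfl
    have hQc : Qᵀ * colM (cvec Q a₁ lam) = 0 := by
      rw [mul_colM, transpose_mulVec_cvec hQ]
      rfl
    rw [Matrix.fromBlocks_transpose, Matrix.fromBlocks_multiply, hQ, hcQ, hQc,
      transpose_colM_mul_colM, Matrix.transpose_smul, Matrix.transpose_one, smul_mul_smul_comm,
      Matrix.mul_one, ← add_smul, cvec_dotProduct_cvec_add Q a₁ hlam]
    simp
end

section
/- Let m, n, c be positive integers, A an m×n real matrix, B an m×c real matrix, λ a nonzero real number, a₁ ∈ ℝⁿ, and b₁ ∈ ℝ^c. Define X* := Aᵀ(AAᵀ + λ²Iₘ)⁻¹B, Ã := [A; a₁ᵀ] (the (m+1)×n matrix appending row a₁ᵀ to A), B̃ := [B; b₁ᵀ], and X̃* := Ãᵀ(ÃÃᵀ + λ²I_{m+1})⁻¹B̃. Let r := b₁ᵀ − a₁ᵀX* ∈ ℝ^{1×c} (a row vector) and suppose l ∈ Fin c is an index with r_l ≠ 0. Let x̃_l := Ãᵀ(ÃÃᵀ + λ²I_{m+1})⁻¹(B̃ e_l) ∈ ℝⁿ be the l-th column of X̃* and x*_l := X* e_l ∈ ℝⁿ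 the l-th column of X*, where e_l is the l-th standard basis column. Then X̃* = X* + (1/r_l)·(x̃_l − x*_l)·r, where (x̃_l − x*_l)·r denotes the n×c outer product of the column vector x̃_l − x*_l with the row vector r. -/
open Matrix

/-- `X* = Aᵀ (A Aᵀ + λ² Iₘ)⁻¹ B`, the Tikhonov solution. -/
noncomputable def Xstar {m n c : ℕ} (A : Matrix (Fin m) (Fin n) ℝ)
    (B : Matrix (Fin m) (Fin c) ℝ) (lam : ℝ) : Matrix (Fin n) (Fin c) ℝ :=
  Aᵀ * (A * Aᵀ + lam ^ 2 • (1 : Matrix (Fin m) (Fin m) ℝ))⁻¹ * B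

/-- `Ã = [A; a₁ᵀ]`, appending the row `a₁ᵀ` to `A`. -/
def Atil {m n : ℕ} (A : Matrix (Fin m) (Fin n) ℝ) (a₁ : Fin n → ℝ) :
    Matrix (Fin m ⊕ Unit) (Fin n) ℝ :=
  Matrix.fromRows A (Matrix.of fun (_ : Unit) j => a₁ j)

/-- `B̃ = [B; b₁ᵀ]`, appending the row `b₁ᵀ` to `B`. -/
def Btil {m c : ℕ} (B : Matrix (Fin m) (Fin c) ℝ) (b₁ : Fin c → ℝ) :
    Matrix (Fin m ⊕ Unit) (Fin c) ℝ :=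
  Matrix.fromRows B (Matrix.of fun (_ : Unit) j => b₁ j)

/-- `X̃* = Ãᵀ (Ã Ãᵀ + λ² I_{m+1})⁻¹ B̃`, the Tikhonov solution of the augmented system. -/
noncomputable def XtilStar {m n c : ℕ} (A : Matrix (Fin m) (Fin n) ℝ)
    (B : Matrix (Fin m) (Fin c) ℝ) (lam : ℝ) (a₁ : Fin n → ℝ) (b₁ : Fin c → ℝ) :
    Matrix (Fin n) (Fin c) ℝ :=
  (Atil A a₁)ᵀ *
    (Atil A a₁ * (Atil A a₁)ᵀ + lam ^ 2 • (1 : Matrix (Fin m ⊕ Unit) (Fin m ⊕ Unit) ℝ))⁻¹ *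
    Btil B b₁

/-- The residual row vector `r = b₁ᵀ − a₁ᵀ X*`. -/
noncomputable def resid {m n c : ℕ} (A : Matrix (Fin m) (Fin n) ℝ)
    (B : Matrix (Fin m) (Fin c) ℝ) (lam : ℝ) (a₁ : Fin n → ℝ) (b₁ : Fin c → ℝ) :
    Fin c → ℝ :=
  b₁ - a₁ ᵥ* Xstar A B lam

/-- `x̃_l = Ãᵀ (Ã Ãᵀ + λ² I)⁻¹ (B̃ e_l)`, the `l`-th column of `X̃*`. -/
noncomputable def xtilCol {m n c : ℕ} (A : Matrix (Fin m) (Fin n) ℝ)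
    (B : Matrix (Fin m) (Fin c) ℝ) (lam : ℝ) (a₁ : Fin n → ℝ) (b₁ : Fin c → ℝ)
    (l : Fin c) : Fin n → ℝ :=
  ((Atil A a₁)ᵀ *
      (Atil A a₁ * (Atil A a₁)ᵀ + lam ^ 2 • (1 : Matrix (Fin m ⊕ Unit) (Fin m ⊕ Unit) ℝ))⁻¹) *ᵥ
    (Btil B b₁ *ᵥ Pi.single l 1)

/-- A Gram matrix shifted by a positive multiple of the identity is invertible. -/
theorem isUnit_mul_transpose_add_smul_one {ι κ : Type*} [Fintype ι] [DecidableEq ι] [Fintype κ]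
    (M : Matrix ι κ ℝ) {lam : ℝ} (hlam : lam ≠ 0) :
    IsUnit (M * Mᵀ + lam ^ 2 • (1 : Matrix ι ι ℝ)) := by
  have h : (M * Mᵀ).PosSemidef := by
    simpa using Matrix.posSemidef_self_mul_conjTranspose M
  have h1 : (lam ^ 2 • (1 : Matrix ι ι ℝ)).PosDef :=
    Matrix.PosDef.one.smul (by positivity)
  exact (Matrix.PosDef.posSemidef_add h h1).isUnit

/-- The Tikhonov solution in dual form satisfies the regularized normal equations. -/
theorem tikhonov_normal_equation {ι κ γ : Type*} [Fintype ι] [DecidableEq ι] [Fintype κ]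
    [DecidableEq κ] (M : Matrix ι κ ℝ) (C : Matrix ι γ ℝ) {lam : ℝ} (hlam : lam ≠ 0) :
    (Mᵀ * M + lam ^ 2 • (1 : Matrix κ κ ℝ)) *
      (Mᵀ * (M * Mᵀ + lam ^ 2 • (1 : Matrix ι ι ℝ))⁻¹ * C) = Mᵀ * C := by
  have hdet := (Matrix.isUnit_iff_isUnit_det _).1 (isUnit_mul_transpose_add_smul_one M hlam)
  have hpush : (Mᵀ * M + lam ^ 2 • (1 : Matrix κ κ ℝ)) * Mᵀ =
      Mᵀ * (M * Mᵀ + lam ^ 2 • (1 : Matrix ι ι ℝ)) := by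
    simp [Matrix.add_mul, Matrix.mul_add, Matrix.mul_assoc]
  rw [← Matrix.mul_assoc, ← Matrix.mul_assoc, hpush, Matrix.mul_assoc Mᵀ,
    Matrix.mul_nonsing_inv _ hdet, Matrix.mul_one]

theorem transpose_Atil_mul_fromRows {m n : ℕ} {γ : Type*} (A : Matrix (Fin m) (Fin n) ℝ)
    (a : Fin n → ℝ) (C : Matrix (Fin m) γ ℝ) (d : γ → ℝ) :
    (Atil A a)ᵀ * Matrix.fromRows C (Matrix.of fun (_ : Unit) j => d j) =
      Aᵀ * C + vecMulVec a d := by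
  ext i j
  simp [Atil, Matrix.mul_apply, vecMulVec_apply]

/-- Appending a row changes the Tikhonov solution by a rank-one matrix whose row factor is the
residual of the new row. -/
theorem exists_XtilStar_eq_add_vecMulVec {m n c : ℕ} (A : Matrix (Fin m) (Fin n) ℝ)
    (B : Matrix (Fin m) (Fin c) ℝ) {lam : ℝ} (hlam : lam ≠ 0) (a₁ : Fin n → ℝ)
    (b₁ : Fin c → ℝ) :
    ∃ v : Fin n → ℝ,
      XtilStar A B lam a₁ b₁ = Xstar A B lam + vecMulVec v (resid A B lam a₁ b₁) := by
  set G := (Atil A a₁)ᵀ * Atil A a₁ + lam ^ 2 • (1 : Matrix (Fin n) (Fin n) ℝ) with hG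
  have hdet : IsUnit G.det := by
    have h := isUnit_mul_transpose_add_smul_one (Atil A a₁)ᵀ hlam
    rw [Matrix.transpose_transpose] at h
    exact (Matrix.isUnit_iff_isUnit_det _).1 h
  have hnew : G * XtilStar A B lam a₁ b₁ = Aᵀ * B + vecMulVec a₁ b₁ :=
    (tikhonov_normal_equation (Atil A a₁) (Btil B b₁) hlam).trans
      (transpose_Atil_mul_fromRows A a₁ B b₁)
  have hold : G * Xstar A B lam = Aᵀ * B + vecMulVec a₁ (a₁ ᵥ* Xstar A B lam) := by
    have h : G = (Aᵀ * A + lam ^ 2 • (1 : Matrix (Fin n) (Fin n) ℝ)) + vecMulVec a₁ a₁ := by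
      have hgram : (Atil A a₁)ᵀ * Atil A a₁ = Aᵀ * A + vecMulVec a₁ a₁ :=
        transpose_Atil_mul_fromRows A a₁ A a₁
      rw [hG, hgram]
      abel
    rw [h, Matrix.add_mul, Matrix.vecMulVec_mul]
    exact congrArg (· + _) (tikhonov_normal_equation A B hlam)
  refine ⟨G⁻¹ *ᵥ a₁, ?_⟩
  have hdiff : G * XtilStar A B lam a₁ b₁ =
      G * Xstar A B lam + vecMulVec a₁ (resid A B lam a₁ b₁) := by
    rw [hnew, hold, resid, Matrix.vecMulVec_sub]
    abel
  rw [← Matrix.mul_vecMulVec, ← Matrix.nonsing_inv_mul_cancel_left G (XtilStar A B lam a₁ b₁) hdet,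
    hdiff, Matrix.mul_add, Matrix.nonsing_inv_mul_cancel_left _ _ hdet]

theorem stmt9 {m n c : ℕ} (hm : 0 < m) (hn : 0 < n) (hc : 0 < c)
    (A : Matrix (Fin m) (Fin n) ℝ) (B : Matrix (Fin m) (Fin c) ℝ)
    (lam : ℝ) (hlam : lam ≠ 0) (a₁ : Fin n → ℝ) (b₁ : Fin c → ℝ)
    (l : Fin c) (hl : resid A B lam a₁ b₁ l ≠ 0) :
    XtilStar A B lam a₁ b₁ =
      Xstar A B lam +
        (1 / resid A B lam a₁ b₁ l) •
          Matrix.of (fun (i : Fin n) (j : Fin c) =>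
            (xtilCol A B lam a₁ b₁ l i - (Xstar A B lam *ᵥ Pi.single l 1) i) *
              resid A B lam a₁ b₁ j) := by
  obtain ⟨v, hv⟩ := exists_XtilStar_eq_add_vecMulVec A B hlam a₁ b₁
  have hcol : xtilCol A B lam a₁ b₁ l = XtilStar A B lam a₁ b₁ *ᵥ Pi.single l 1 := by
    rw [xtilCol, XtilStar, Matrix.mulVec_mulVec]
  rw [hcol, hv]
  ext i j
  simp only [Matrix.mulVec_single_one, Matrix.col_apply, Matrix.add_apply, Matrix.smul_apply,
    Matrix.of_apply, vecMulVec_apply, smul_eq_mul]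
  field_simp
  ring
end

section
/- Let p, n₁, n₂, n₄ be positive integers and let A : ZMod p → Matrix (Fin n₁) (Fin n₂) ℝ and B : ZMod p → Matrix (Fin n₂) (Fin n₄) ℝ be families of frontal slices. Define their cyclic convolution C : ZMod p → Matrix (Fin n₁) (Fin n₄) ℝ by C k = Σ_{j ∈ ZMod p} (A j) · (B (k − j)), and define the block circulant matrix bcirc(A) : Matrix (ZMod p × Fin n₁) (ZMod p × Fin n₂) ℝ by bcirc(A) (i,r) (j,s) = (A (i − j)) r s, and similarly bcirc(B) and bcirc(C). Then bcirc(C) = bcirc(A) · bcirc(B). -/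
open Matrix

/-- The block circulant matrix of a family of frontal slices:
`bcirc(A) (i,r) (j,s) = A_{(i−j) mod p} r s`. -/
def bcirc {p n₁ n₂ : ℕ} [NeZero p] (A : ZMod p → Matrix (Fin n₁) (Fin n₂) ℝ) :
    Matrix (ZMod p × Fin n₁) (ZMod p × Fin n₂) ℝ :=
  Matrix.of fun ir js => A (ir.1 - js.1) ir.2 js.2

theorem stmt11 (p n₁ n₂ n₄ : ℕ) [NeZero p]
    (hn₁ : 0 < n₁) (hn₂ : 0 < n₂) (hn₄ : 0 < n₄)
    (A : ZMod p → Matrix (Fin n₁) (Fin n₂) ℝ)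
    (B : ZMod p → Matrix (Fin n₂) (Fin n₄) ℝ) :
    bcirc (fun k => ∑ j : ZMod p, A j * B (k - j)) = bcirc A * bcirc B := by
  ext ⟨i, r⟩ ⟨j, s⟩
  simp only [bcirc, Matrix.of_apply, Matrix.mul_apply, Matrix.sum_apply, Fintype.sum_prod_type]
  refine Fintype.sum_equiv (Equiv.subLeft i) _ _ fun k => ?_
  simp [sub_right_comm]
end
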